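/- For every nonempty σ ⊆ X, every p ∈ ℝ², and every r ≥ 0: (σ ∈ Incr(γ), γ(σ) ≤ p, and the smallest enclosing ball of σ has radius at most r) if and only if (⋂_{x ∈ σ} Ball_r(x) ≠ ∅ and ⋂_{x ∈ σ} TelVor(x)_{p,∞} ≠ ∅). -/

import Mathlib

noncomputable section

attribute [local instance] Classical.propDecidable

/-- Euclidean space ℝ^d. -/
abbrev Pt (d : ℕ) := EuclideanSpace ℝ (Fin d)

variable {d : ℕ}

/-- The sphere with center `c` and radius `r` is a circumsphere of the finite set `Q`:
every point of `Q` lies on it. -/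
def OnSphere (c : Pt d) (r : ℝ) (Q : Finset (Pt d)) : Prop :=
  ∀ w ∈ Q, ‖w - c‖ = r

/-- The sphere with center `c` and radius `r` is `Z`-empty: no point of `Z` lies inside it. -/
def SphEmpty (c : Pt d) (r : ℝ) (Z : Finset (Pt d)) : Prop :=
  ∀ z ∈ Z, ¬ ‖z - c‖ < r

/-- The Delaunay triangulation of `Z`: nonempty subsets of `Z` admitting a `Z`-empty
circumsphere. -/
def DelT (Z : Finset (Pt d)) : Set (Finset (Pt d)) :=
  {σ | σ.Nonempty ∧ σ ⊆ Z ∧ ∃ c r, 0 ≤ r ∧ OnSphere c r σ ∧ SphEmpty c r Z}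

/-- `Z` is in general position: every nonempty subset `Q` of at most `d+1` points is affinely
independent, and no point of `Z \ Q` lies on the smallest circumsphere of `Q`. -/
def GenPos (Z : Finset (Pt d)) : Prop :=
  ∀ Q : Finset (Pt d), Q ⊆ Z → Q.Nonempty → Q.card ≤ d + 1 →
    (AffineIndependent ℝ (fun q : ↥(Q : Set (Pt d)) => (q : Pt d))) ∧
    ∀ c r, 0 ≤ r → OnSphere c r Q →
      (∀ c' r', 0 ≤ r' → OnSphere c' r' Q → r ≤ r') →
      ∀ z ∈ Z, z ∉ Q → ‖z - c‖ ≠ r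

/-- The sublevel set `X_p = {x ∈ X : γ(x) ≤ p}` (product order on `ℝ²`). -/
def Xsub (X : Finset (Pt d)) (γ : Pt d → ℝ × ℝ) (p : ℝ × ℝ) : Finset (Pt d) :=
  X.filter fun z => γ z ≤ p

/-- `x` is the point of `σ` with largest `γ₁`-value. -/
def IsMax1 (γ : Pt d → ℝ × ℝ) (σ : Finset (Pt d)) (x : Pt d) : Prop :=
  x ∈ σ ∧ ∀ z ∈ σ, (γ z).1 ≤ (γ x).1

/-- `y` is the point of `σ` with largest `γ₂`-value. -/
def IsMax2 (γ : Pt d → ℝ × ℝ) (σ : Finset (Pt d)) (y : Pt d) : Prop :=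
  y ∈ σ ∧ ∀ z ∈ σ, (γ z).2 ≤ (γ y).2

/-- The sphere of center `c` and radius `r` is a witness of `σ`, where `x = max₁(σ)` and
`y = max₂(σ)`: it is a circumsphere of `σ \ {x,y}`, `x` and `y` lie inside or on it, and it is
`(X_{γ(σ)} \ {x,y})`-empty (note `γ(σ) = (γ₁ x, γ₂ y)`). -/
def IsWitness (X : Finset (Pt d)) (γ : Pt d → ℝ × ℝ) (σ : Finset (Pt d))
    (x y c : Pt d) (r : ℝ) : Prop :=
  (∀ z ∈ σ, z ≠ x → z ≠ y → ‖z - c‖ = r) ∧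
  ‖x - c‖ ≤ r ∧ ‖y - c‖ ≤ r ∧
  ∀ w ∈ Xsub X γ ((γ x).1, (γ y).2), w ≠ x → w ≠ y → ¬ ‖w - c‖ < r

/-- The incremental Delaunay complex `Incr(γ)`: nonempty subsets of `X` admitting a witness. -/
def Incr (X : Finset (Pt d)) (γ : Pt d → ℝ × ℝ) : Set (Finset (Pt d)) :=
  {σ | σ.Nonempty ∧ σ ⊆ X ∧
    ∃ x y c r, IsMax1 γ σ x ∧ IsMax2 γ σ y ∧ 0 ≤ r ∧ IsWitness X γ σ x y c r}

/-- The incremental Delaunay radius `ω_σ`: the minimum radius of a witness of `σ`. -/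
def omegaRad (X : Finset (Pt d)) (γ : Pt d → ℝ × ℝ) (σ : Finset (Pt d)) : ℝ :=
  sInf {r | 0 ≤ r ∧ ∃ x y c, IsMax1 γ σ x ∧ IsMax2 γ σ y ∧ IsWitness X γ σ x y c r}

/-- `γ(σ)`: the coordinatewise maximum of `γ` over the nonempty finite set `σ`. -/
def gammaJoin (γ : Pt d → ℝ × ℝ) (σ : Finset (Pt d)) (h : σ.Nonempty) : ℝ × ℝ :=
  (σ.sup' h fun z => (γ z).1, σ.sup' h fun z => (γ z).2)

/-- `(σ, x)` is a conflict pair at `p ∈ Grid(γ)`: `σ` is a `d`-simplex of `DelT(X_p)`, `x` lies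
inside the circumsphere of `σ`, and either `p₁ < max(im γ₁)` and `x ∈ X_{p→}`, or
`p₂ < max(im γ₂)` and `x ∈ X_{p↑}` (the successor being expressed by its defining property). -/
def ConflictAt (X : Finset (Pt d)) (γ : Pt d → ℝ × ℝ) (p : ℝ × ℝ)
    (σ : Finset (Pt d)) (x : Pt d) : Prop :=
  p.1 ∈ X.image (fun z => (γ z).1) ∧ p.2 ∈ X.image (fun z => (γ z).2) ∧
  σ ∈ DelT (Xsub X γ p) ∧ σ.card = d + 1 ∧
  (∃ c r, 0 ≤ r ∧ OnSphere c r σ ∧ ‖x - c‖ < r) ∧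
  ((∃ a ∈ X.image (fun z => (γ z).1), p.1 < a ∧
      (∀ b ∈ X.image (fun z => (γ z).1), p.1 < b → a ≤ b) ∧
      x ∈ Xsub X γ (a, p.2)) ∨
   (∃ a ∈ X.image (fun z => (γ z).2), p.2 < a ∧
      (∀ b ∈ X.image (fun z => (γ z).2), p.2 < b → a ≤ b) ∧
      x ∈ Xsub X γ (p.1, a)))

/-- `(σ, x)` is a conflict pair: it is a conflict pair at some `p ∈ Grid(γ)`. -/
def ConflictPair (X : Finset (Pt d)) (γ : Pt d → ℝ × ℝ)
    (σ : Finset (Pt d)) (x : Pt d) : Prop :=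
  ∃ p, ConflictAt X γ p σ x

/-- `Δ` witnesses the Δ-property of `X`: `Δ` consists of `d+1` points of `X` which come first in
both the `γ₁`- and `γ₂`-orders, the two orders agree on `Δ`, and `X` is contained in the convex
hull of `Δ`. -/
def IsDelta (X : Finset (Pt d)) (γ : Pt d → ℝ × ℝ) (Δ : Finset (Pt d)) : Prop :=
  Δ ⊆ X ∧ Δ.card = d + 1 ∧
  (∀ a ∈ Δ, ∀ b ∈ X, b ∉ Δ → (γ a).1 < (γ b).1 ∧ (γ a).2 < (γ b).2) ∧
  (∀ a ∈ Δ, ∀ b ∈ Δ, ((γ a).1 ≤ (γ b).1 ↔ (γ a).2 ≤ (γ b).2)) ∧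
  (↑X : Set (Pt d)) ⊆ convexHull ℝ (↑Δ : Set (Pt d))

/-- The Voronoi cell of `x` with respect to `Y`. -/
def VorCell (x : Pt d) (Y : Set (Pt d)) : Set (Pt d) :=
  {w | ∀ y ∈ Y, ‖w - x‖ ≤ ‖w - y‖}

/-- The telescopic Voronoi cell `Tel(x)`: the closure of `⋃_{q ≥ γ(x)} Vor(x, X_q) × {q}`. -/
def Tel (X : Finset (Pt d)) (γ : Pt d → ℝ × ℝ) (x : Pt d) : Set (Pt d × (ℝ × ℝ)) :=
  closure {z | γ x ≤ z.2 ∧ z.1 ∈ VorCell x (↑(Xsub X γ z.2) : Set (Pt d))}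

/-- The telescopic Voronoi ball `TelVor(x)_{p,r}`. -/
def TelVor (X : Finset (Pt d)) (γ : Pt d → ℝ × ℝ) (x : Pt d) (p : ℝ × ℝ) (r : ℝ) :
    Set (Pt d × (ℝ × ℝ)) :=
  Tel X γ x ∩ {z | z.1 ∈ Metric.closedBall x r ∧ z.2 ≤ p}

/-- The telescopic Voronoi cell `TelVor(x)_{p,∞}`. -/
def TelVorInf (X : Finset (Pt d)) (γ : Pt d → ℝ × ℝ) (x : Pt d) (p : ℝ × ℝ) :
    Set (Pt d × (ℝ × ℝ)) :=
  Tel X γ x ∩ {z | z.2 ≤ p}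

/-- The radius of the smallest enclosing ball of `σ`. -/
def miniballRadius (σ : Finset (Pt d)) : ℝ :=
  sInf {r | 0 ≤ r ∧ ∃ c : Pt d, ∀ x ∈ σ, ‖x - c‖ ≤ r}

/-- The Delaunay radius `b_σ`: the minimum radius of a `Z`-empty circumsphere of `σ`. -/
def delRad (Z σ : Finset (Pt d)) : ℝ :=
  sInf {r | 0 ≤ r ∧ ∃ c, OnSphere c r σ ∧ SphEmpty c r Z}

/-- The telescopic offset `TelOffset_{p,r} ⊆ ℝ^d × ℝ²`. -/
def TelOffsetSet (X : Finset (Pt d)) (γ : Pt d → ℝ × ℝ) (p : ℝ × ℝ) (r : ℝ) :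
    Set (Pt d × (ℝ × ℝ)) :=
  ⋃ x ∈ X, Metric.closedBall x r ×ˢ {q : ℝ × ℝ | γ x ≤ q ∧ q ≤ p}

/-- The sublevel offset `Offset_{p,r} ⊆ ℝ^d`. -/
def OffsetSet (X : Finset (Pt d)) (γ : Pt d → ℝ × ℝ) (p : ℝ × ℝ) (r : ℝ) : Set (Pt d) :=
  ⋃ x ∈ Xsub X γ p, Metric.closedBall x r

/-- `OU_r = ⋃_{x ∈ X} Ball_r(x) × Vor(x,X) ⊆ ℝ^d × ℝ^d`. -/
def OUSet (X : Finset (Pt d)) (r : ℝ) : Set (Pt d × Pt d) :=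
  ⋃ x ∈ X, Metric.closedBall x r ×ˢ VorCell x (↑X : Set (Pt d))

/-- `Offset(X)_r = ⋃_{x ∈ X} Ball_r(x) ⊆ ℝ^d`. -/
def OffsetR (X : Finset (Pt d)) (r : ℝ) : Set (Pt d) :=
  ⋃ x ∈ X, Metric.closedBall x r

/-- `OTelDC_{p,r} ⊆ ℝ^d × ℝ^d × ℝ²`. -/
def OTelDCSet (X : Finset (Pt d)) (γ : Pt d → ℝ × ℝ) (p : ℝ × ℝ) (r : ℝ) :
    Set (Pt d × Pt d × (ℝ × ℝ)) :=
  {z | z.2.2 ≤ p ∧ ∃ x ∈ Xsub X γ z.2.2,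
    ‖x - z.1‖ ≤ r ∧ z.2.1 ∈ VorCell x (↑(Xsub X γ z.2.2) : Set (Pt d))}

/-- Up to injectivity of the two coordinates of `γ`, taking the closure in `Tel` replaces the
sublevel set at `q` by the points lying strictly below `q` in both coordinates. -/
theorem mem_Tel_iff {X : Finset (Pt d)} {γ : Pt d → ℝ × ℝ}
    (hinj1 : Set.InjOn (fun z => (γ z).1) (↑X : Set (Pt d)))
    (hinj2 : Set.InjOn (fun z => (γ z).2) (↑X : Set (Pt d)))
    {x : Pt d} (hx : x ∈ X) (w : Pt d) (q : ℝ × ℝ) :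
    (w, q) ∈ Tel X γ x ↔
      γ x ≤ q ∧ ∀ z ∈ X, (γ z).1 < q.1 → (γ z).2 < q.2 → ‖w - x‖ ≤ ‖w - z‖ := by
  constructor
  · intro h
    let C : Set (Pt d × (ℝ × ℝ)) := {u | γ x ≤ u.2} ∩ ⋂ z ∈ X,
      ({u | u.2.1 ≤ (γ z).1} ∪ {u | u.2.2 ≤ (γ z).2} ∪ {u | ‖u.1 - x‖ ≤ ‖u.1 - z‖})
    have hC : IsClosed C := by
      refine (isClosed_le continuous_const continuous_snd).inter
        (isClosed_biInter fun z _ => ((isClosed_le ?_ ?_).union (isClosed_le ?_ ?_)).union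
          (isClosed_le ?_ ?_)) <;> fun_prop
    have hsub : {u : Pt d × (ℝ × ℝ) | γ x ≤ u.2 ∧
        u.1 ∈ VorCell x (↑(Xsub X γ u.2) : Set (Pt d))} ⊆ C := by
      rintro ⟨v, s⟩ ⟨h1, h2⟩
      refine ⟨h1, Set.mem_iInter₂.2 fun z hz => ?_⟩
      by_cases h3 : s.1 ≤ (γ z).1
      · exact Or.inl (Or.inl h3)
      by_cases h4 : s.2 ≤ (γ z).2
      · exact Or.inl (Or.inr h4)
      refine Or.inr (h2 z ?_)
      simp only [Xsub, Finset.coe_filter, Set.mem_ofPred_eq]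
      exact ⟨hz, (not_le.1 h3).le, (not_le.1 h4).le⟩
    obtain ⟨h1, h2⟩ := closure_minimal hsub hC h
    refine ⟨h1, fun z hz hz1 hz2 => ?_⟩
    rcases Set.mem_iInter₂.1 h2 z hz with (h3 | h3) | h3
    · exact absurd hz1 (not_lt.2 h3)
    · exact absurd hz2 (not_lt.2 h3)
    · exact h3
  · rintro ⟨hq, hw⟩
    let f : ℝ → Pt d × (ℝ × ℝ) := fun t => (w, (max (γ x).1 (q.1 - t), max (γ x).2 (q.2 - t)))
    have hf : Continuous f := by fun_prop
    have hf0 : f 0 = (w, q) := by simp [f, hq.1, hq.2]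
    have ht : Filter.Tendsto f (nhdsWithin 0 (Set.Ioi 0)) (nhds (w, q)) :=
      hf0 ▸ hf.continuousAt.tendsto.mono_left nhdsWithin_le_nhds
    refine mem_closure_of_tendsto ht (Filter.eventually_of_mem self_mem_nhdsWithin ?_)
    intro t ht0
    have ht0 : 0 < t := ht0
    refine ⟨⟨le_max_left _ _, le_max_left _ _⟩, fun z hz => ?_⟩
    simp only [Xsub, Finset.coe_filter, Set.mem_ofPred_eq] at hz
    obtain ⟨hzX, hz1, hz2⟩ := hz
    by_cases hzx : z = x
    · rw [hzx]
    have hne1 : (γ z).1 ≠ (γ x).1 := fun h => hzx (hinj1 hzX hx h)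
    have hne2 : (γ z).2 ≠ (γ x).2 := fun h => hzx (hinj2 hzX hx h)
    refine hw z hzX ?_ ?_
    · rcases le_max_iff.1 hz1 with h | h
      · exact (lt_of_le_of_ne h hne1).trans_le hq.1
      · linarith
    · rcases le_max_iff.1 hz2 with h | h
      · exact (lt_of_le_of_ne h hne2).trans_le hq.2
      · linarith

/-- The smallest enclosing ball exists: its radius is at most `r` iff the balls of radius `r`
around the points of `σ` have a common point. -/
theorem miniballRadius_le_iff {σ : Finset (Pt d)} (hne : σ.Nonempty) {r : ℝ} (hr : 0 ≤ r) :
    miniballRadius σ ≤ r ↔ (⋂ x ∈ σ, Metric.closedBall x r).Nonempty := by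
  have hball : ∀ (c : Pt d) (s : ℝ),
      c ∈ (⋂ x ∈ σ, Metric.closedBall x s) ↔ ∀ x ∈ σ, ‖x - c‖ ≤ s := by
    intro c s
    simp [dist_eq_norm, norm_sub_rev c]
  have hbdd : BddBelow {r | 0 ≤ r ∧ ∃ c : Pt d, ∀ x ∈ σ, ‖x - c‖ ≤ r} := ⟨0, fun _ h => h.1⟩
  constructor
  · intro h
    let f : Pt d → ℝ := fun c => σ.sup' hne fun x => ‖x - c‖
    have hf : Continuous f := Continuous.finset_sup'_apply hne fun x _ => by fun_prop
    have hexists : ∀ s, r < s → ∃ c, f c < s := by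
      intro s hs
      have hset : {r | 0 ≤ r ∧ ∃ c : Pt d, ∀ x ∈ σ, ‖x - c‖ ≤ r}.Nonempty := by
        obtain ⟨a, ha⟩ := hne
        exact ⟨f 0, (norm_nonneg _).trans (Finset.le_sup' (fun x => ‖x - 0‖) ha), 0,
          fun x hx => Finset.le_sup' (fun x => ‖x - 0‖) hx⟩
      obtain ⟨t, ⟨-, c, hc⟩, hts⟩ := exists_lt_of_csInf_lt hset (lt_of_le_of_lt h hs)
      exact ⟨c, (Finset.sup'_le hne _ hc).trans_lt hts⟩
    have hmem : ∀ c s, c ∈ (⋂ x ∈ σ, Metric.closedBall x s) ↔ f c ≤ s := by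
      intro c s
      rw [hball, Finset.sup'_le_iff]
    have hK : IsCompact (⋂ x ∈ σ, Metric.closedBall x (r + 1)) := by
      obtain ⟨a, ha⟩ := hne
      exact (isCompact_closedBall a (r + 1)).of_isClosed_subset
        (isClosed_biInter fun _ _ => Metric.isClosed_closedBall) (Set.biInter_subset_of_mem ha)
    obtain ⟨c₀, hc₀⟩ := hexists (r + 1) (by linarith)
    obtain ⟨c, -, hc⟩ := hK.exists_isMinOn ⟨c₀, (hmem _ _).2 hc₀.le⟩ hf.continuousOn
    refine ⟨c, (hmem _ _).2 (not_lt.1 fun hlt => ?_)⟩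
    obtain ⟨c', hc'⟩ := hexists (min (f c) (r + 1)) (lt_min hlt (by linarith))
    obtain ⟨h1, h2⟩ := lt_min_iff.1 hc'
    exact absurd h1 (not_lt.2 (hc ((hmem _ _).2 h2.le)))
  · rintro ⟨c, hc⟩
    exact csInf_le hbdd ⟨hr, c, (hball c r).1 hc⟩

/-- `σ ∈ Incr(γ)` and `γ(σ) ≤ p` iff the telescopic Voronoi cells at `p` of the points of `σ`
have a common point. -/
theorem mem_Incr_and_gammaJoin_le_iff {X : Finset (Pt d)} {γ : Pt d → ℝ × ℝ}
    (hinj1 : Set.InjOn (fun z => (γ z).1) (↑X : Set (Pt d)))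
    (hinj2 : Set.InjOn (fun z => (γ z).2) (↑X : Set (Pt d)))
    {σ : Finset (Pt d)} (hne : σ.Nonempty) (hsub : σ ⊆ X) (p : ℝ × ℝ) :
    (σ ∈ Incr X γ ∧ gammaJoin γ σ hne ≤ p) ↔ (⋂ x ∈ σ, TelVorInf X γ x p).Nonempty := by
  constructor
  · rintro ⟨⟨-, -, x, y, c, r, hx, hy, -, hcirc, hxr, hyr, hempty⟩, hp⟩
    refine ⟨(c, ((γ x).1, (γ y).2)), Set.mem_iInter₂.2 fun s hs => ⟨?_, ?_, ?_⟩⟩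
    · refine (mem_Tel_iff hinj1 hinj2 (hsub hs) _ _).2
        ⟨⟨hx.2 s hs, hy.2 s hs⟩, fun z hz hz1 hz2 => ?_⟩
      have hsr : ‖s - c‖ ≤ r := by
        by_cases hsx : s = x
        · rwa [hsx]
        by_cases hsy : s = y
        · rwa [hsy]
        exact (hcirc s hs hsx hsy).le
      have hzr : r ≤ ‖z - c‖ := by
        refine not_lt.1 (hempty z (Finset.mem_filter.2 ⟨hz, hz1.le, hz2.le⟩) ?_ ?_)
        · rintro rfl
          exact lt_irrefl _ hz1
        · rintro rfl
          exact lt_irrefl _ hz2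
      rw [norm_sub_rev c s, norm_sub_rev c z]
      exact hsr.trans hzr
    · exact (Finset.le_sup' (fun z => (γ z).1) hx.1).trans hp.1
    · exact (Finset.le_sup' (fun z => (γ z).2) hy.1).trans hp.2
  · rintro ⟨⟨w, q⟩, hwq⟩
    have hmem : ∀ s ∈ σ, γ s ≤ q ∧
        ∀ z ∈ X, (γ z).1 < q.1 → (γ z).2 < q.2 → ‖w - s‖ ≤ ‖w - z‖ := fun s hs =>
      (mem_Tel_iff hinj1 hinj2 (hsub hs) w q).1 (Set.mem_iInter₂.1 hwq s hs).1
    have hqp : q ≤ p := by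
      obtain ⟨a, ha⟩ := hne
      exact (Set.mem_iInter₂.1 hwq a ha).2
    refine ⟨⟨hne, hsub, ?_⟩, Finset.sup'_le hne _ fun s hs => ((hmem s hs).1.trans hqp).1,
      Finset.sup'_le hne _ fun s hs => ((hmem s hs).1.trans hqp).2⟩
    obtain ⟨x, hx, hxmax⟩ := σ.exists_max_image (fun z => (γ z).1) hne
    obtain ⟨y, hy, hymax⟩ := σ.exists_max_image (fun z => (γ z).2) hne
    obtain ⟨m, hm, hmmax⟩ := σ.exists_max_image (fun z => ‖z - w‖) hne
    have hfar : ∀ z ∈ Xsub X γ ((γ x).1, (γ y).2), z ≠ x → z ≠ y → ‖m - w‖ ≤ ‖z - w‖ := by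
      intro z hz hzx hzy
      obtain ⟨hzX, hz1, hz2⟩ := Finset.mem_filter.1 hz
      rw [norm_sub_rev m, norm_sub_rev z]
      exact (hmem m hm).2 z hzX
        ((lt_of_le_of_ne hz1 fun h => hzx (hinj1 hzX (hsub hx) h)).trans_le (hmem x hx).1.1)
        ((lt_of_le_of_ne hz2 fun h => hzy (hinj2 hzX (hsub hy) h)).trans_le (hmem y hy).1.2)
    exact ⟨x, y, w, ‖m - w‖, ⟨hx, hxmax⟩, ⟨hy, hymax⟩, norm_nonneg _,
      fun z hz hzx hzy => le_antisymm (hmmax z hz)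
        (hfar z (Finset.mem_filter.2 ⟨hsub hz, hxmax z hz, hymax z hz⟩) hzx hzy),
      hmmax x hx, hmmax y hy, fun z hz hzx hzy => not_lt.2 (hfar z hz hzx hzy)⟩

/-- `σ ∈ Incr(γ)`, `γ(σ) ≤ p`, and the smallest enclosing ball of `σ` has radius
at most `r` iff `⋂_{x ∈ σ} Ball_r(x) ≠ ∅` and `⋂_{x ∈ σ} TelVor(x)_{p,∞} ≠ ∅`. -/
theorem delCechIffBallsAndTelVor
    {d : ℕ} (hd : 1 ≤ d) (X : Finset (Pt d)) (γ : Pt d → ℝ × ℝ)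
    (hgen : GenPos X)
    (hinj1 : Set.InjOn (fun z => (γ z).1) (↑X : Set (Pt d)))
    (hinj2 : Set.InjOn (fun z => (γ z).2) (↑X : Set (Pt d)))
    (σ : Finset (Pt d)) (hne : σ.Nonempty) (hsub : σ ⊆ X)
    (p : ℝ × ℝ) (r : ℝ) (hr : 0 ≤ r) :
    (σ ∈ Incr X γ ∧ gammaJoin γ σ hne ≤ p ∧ miniballRadius σ ≤ r) ↔
      ((⋂ x ∈ σ, Metric.closedBall x r).Nonempty ∧
       (⋂ x ∈ σ, TelVorInf X γ x p).Nonempty) := by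
  rw [← and_assoc, mem_Incr_and_gammaJoin_le_iff hinj1 hinj2 hne hsub p,
    miniballRadius_le_iff hne hr, and_comm]
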